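/- arXiv:2005.13664 — 2 statements merged into one kernel-verified Lean document; each statement's English description precedes it below -/
import Mathlib

section
/- Let Φ be a volume-preserving smooth circle action on an open set U ⊆ ℝ³ with infinitesimal generator u and averaged metric ḡ. Then the directional derivative of x ↦ det ḡ(x) along u vanishes: ⟨∇(det ḡ)(x), u(x)⟩ = 0 for every x ∈ U; equivalently, the density ρ_ḡ = √(det ḡ) satisfies ⟨∇ρ_ḡ(x), u(x)⟩ = 0. -/
open Matrix MeasureTheory
open scoped Real

noncomputable section

/-- Vectors in ℝ³. -/
abbrev V3 := Fin 3 → ℝ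

/-- Partial derivative of a scalar field in the `i`-th coordinate direction. -/
def pd (i : Fin 3) (f : V3 → ℝ) (x : V3) : ℝ := fderiv ℝ f x (Pi.single i 1)

/-- Gradient of a scalar field, componentwise from partial derivatives. -/
def grad (f : V3 → ℝ) (x : V3) : V3 := fun i => pd i f x

/-- Curl of a vector field, componentwise from partial derivatives. -/
def curl (w : V3 → V3) (x : V3) : V3 :=
  ![pd 1 (fun y => w y 2) x - pd 2 (fun y => w y 1) x,
    pd 2 (fun y => w y 0) x - pd 0 (fun y => w y 2) x,
    pd 0 (fun y => w y 1) x - pd 1 (fun y => w y 0) x]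

/-- Divergence of a vector field. -/
def div3 (w : V3 → V3) (x : V3) : ℝ := ∑ i, pd i (fun y => w y i) x

/-- Jacobian matrix of a map `f : ℝ³ → ℝ³` at `x`. -/
def jacobian (f : V3 → V3) (x : V3) : Matrix (Fin 3) (Fin 3) ℝ :=
  Matrix.of fun i j => pd j (fun y => f y i) x

/-- A smooth circle action on a set `U ⊆ ℝ³`. -/
structure SmoothCircleAction (U : Set V3) where
  act : ℝ → V3 → V3
  smooth : ContDiffOn ℝ (⊤ : ℕ∞) (fun p : ℝ × V3 => act p.1 p.2) (Set.univ ×ˢ U)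
  mapsTo : ∀ θ : ℝ, Set.MapsTo (act θ) U U
  periodic : ∀ θ : ℝ, ∀ x ∈ U, act (θ + 2 * π) x = act θ x
  act_zero : ∀ x ∈ U, act 0 x = x
  act_add : ∀ θ₁ θ₂ : ℝ, ∀ x ∈ U, act (θ₁ + θ₂) x = act θ₁ (act θ₂ x)

/-- Infinitesimal generator of a circle action. -/
def gen (Φ : ℝ → V3 → V3) (x : V3) : V3 := deriv (fun θ => Φ θ x) 0

/-- The action is volume preserving: the Jacobian determinant is `1`. -/
def VolumePreserving (U : Set V3) (Φ : ℝ → V3 → V3) : Prop :=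
  ∀ θ : ℝ, ∀ x ∈ U, (jacobian (Φ θ) x).det = 1

/-- The action preserves (pushes forward) the vector field `w`. -/
def PreservesVec (U : Set V3) (Φ : ℝ → V3 → V3) (w : V3 → V3) : Prop :=
  ∀ θ : ℝ, ∀ x ∈ U, (jacobian (Φ θ) x).mulVec (w x) = w (Φ θ x)

/-- The action preserves the scalar field `f`. -/
def PreservesFn (U : Set V3) (Φ : ℝ → V3 → V3) (f : V3 → ℝ) : Prop :=
  ∀ θ : ℝ, ∀ x ∈ U, f (Φ θ x) = f x

/-- The averaged metric `ḡ(x) = (1/2π)∫₀^{2π} DΦ_θ(x)ᵀ DΦ_θ(x) dθ`, entrywise. -/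
def avgMetric (Φ : ℝ → V3 → V3) (x : V3) : Matrix (Fin 3) (Fin 3) ℝ :=
  Matrix.of fun i j =>
    (1 / (2 * π)) * ∫ θ in (0:ℝ)..(2 * π), ((jacobian (Φ θ) x)ᵀ * jacobian (Φ θ) x) i j

/-- The averaged covector field `Ā(x) = (1/2π)∫₀^{2π} DΦ_θ(x)ᵀ A(Φ_θ(x)) dθ`, componentwise. -/
def avgCov (Φ : ℝ → V3 → V3) (A : V3 → V3) (x : V3) : V3 :=
  fun i => (1 / (2 * π)) * ∫ θ in (0:ℝ)..(2 * π), (jacobian (Φ θ) x)ᵀ.mulVec (A (Φ θ x)) i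


theorem jacobian_eq_toMatrix' {f : V3 → V3} {x : V3} (hf : DifferentiableAt ℝ f x) :
    jacobian f x = LinearMap.toMatrix' (fderiv ℝ f x : V3 →ₗ[ℝ] V3) := by
  ext i j
  simp only [jacobian, pd, Matrix.of_apply, LinearMap.toMatrix'_apply]
  rw [fderiv_apply hf]
  simp

theorem jacobian_comp {f h : V3 → V3} {x : V3} (hf : DifferentiableAt ℝ f (h x))
    (hh : DifferentiableAt ℝ h x) :
    jacobian (fun y => f (h y)) x = jacobian f (h x) * jacobian h x := by
  have hfh : DifferentiableAt ℝ (fun y => f (h y)) x := hf.comp x hh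
  rw [jacobian_eq_toMatrix' hfh, jacobian_eq_toMatrix' hf, jacobian_eq_toMatrix' hh,
    ← LinearMap.toMatrix'_comp, ← ContinuousLinearMap.toLinearMap_comp, ← fderiv_comp x hf hh]
  rfl

theorem jacobian_congr {f h : V3 → V3} {x : V3} (hfh : f =ᶠ[nhds x] h) :
    jacobian f x = jacobian h x := by
  ext i j
  have hi : (fun y => f y i) =ᶠ[nhds x] fun y => h y i := hfh.fun_comp (fun v : V3 => v i)
  simp only [jacobian, pd, Matrix.of_apply, hi.fderiv_eq]

theorem grad_dotProduct (f : V3 → ℝ) (x v : V3) : grad f x ⬝ᵥ v = fderiv ℝ f x v := by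
  conv_rhs => rw [pi_eq_sum_univ' v, map_sum]
  refine Finset.sum_congr rfl fun i _ => ?_
  rw [map_smul, smul_eq_mul, mul_comm]
  rfl

namespace SmoothCircleAction

variable {U : Set V3} (Φ : SmoothCircleAction U)

theorem contDiffAt (hU : IsOpen U) (θ : ℝ) {x : V3} (hx : x ∈ U) :
    ContDiffAt ℝ (⊤ : ℕ∞) (fun p : ℝ × V3 => Φ.act p.1 p.2) (θ, x) :=
  Φ.smooth.contDiffAt ((isOpen_univ.prod hU).mem_nhds ⟨Set.mem_univ _, hx⟩)

theorem differentiableAt_act (hU : IsOpen U) (θ : ℝ) {x : V3} (hx : x ∈ U) :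
    DifferentiableAt ℝ (Φ.act θ) x := by
  have h := (Φ.contDiffAt hU θ hx).differentiableAt (by simp)
  exact h.comp x ((differentiableAt_const θ).prodMk differentiableAt_id)

theorem differentiableAt_orbit (hU : IsOpen U) (θ : ℝ) {x : V3} (hx : x ∈ U) :
    DifferentiableAt ℝ (fun θ => Φ.act θ x) θ := by
  have h := (Φ.contDiffAt hU θ hx).differentiableAt (by simp)
  exact h.comp (f := fun θ : ℝ => (θ, x)) θ (by fun_prop)

theorem jacobian_act_apply (hU : IsOpen U) (θ : ℝ) {x : V3} (hx : x ∈ U) (i j : Fin 3) :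
    jacobian (Φ.act θ) x i j =
      fderiv ℝ (fun p : ℝ × V3 => Φ.act p.1 p.2) (θ, x) (0, Pi.single j 1) i := by
  have h := (Φ.contDiffAt hU θ hx).differentiableAt (by simp)
  have hc : HasFDerivAt (Φ.act θ) _ x :=
    h.hasFDerivAt.comp x (hasFDerivAt_prodMk_right θ x)
  simp only [jacobian, pd, Matrix.of_apply]
  rw [fderiv_apply hc.differentiableAt, hc.fderiv]
  simp

theorem continuous_jacobian (hU : IsOpen U) {x : V3} (hx : x ∈ U) :
    Continuous fun θ => jacobian (Φ.act θ) x := by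
  refine continuous_matrix fun i j => ?_
  simp only [Φ.jacobian_act_apply hU _ hx]
  refine (continuous_apply i).comp (Continuous.clm_apply ?_ continuous_const)
  refine continuous_iff_continuousAt.2 fun θ => ?_
  have h := ((Φ.contDiffAt hU θ hx).fderiv_right (m := 0) (by simp)).continuousAt
  exact h.comp (f := fun θ : ℝ => (θ, x)) (by fun_prop)

theorem jacobian_act_add (hU : IsOpen U) (θ s : ℝ) {x : V3} (hx : x ∈ U) :
    jacobian (Φ.act (θ + s)) x =
      jacobian (Φ.act θ) (Φ.act s x) * jacobian (Φ.act s) x := by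
  rw [← jacobian_comp (Φ.differentiableAt_act hU θ (Φ.mapsTo s hx))
    (Φ.differentiableAt_act hU s hx)]
  exact jacobian_congr (Filter.eventually_of_mem (hU.mem_nhds hx) fun y hy => Φ.act_add θ s y hy)

theorem jacobian_act_periodic (hU : IsOpen U) {x : V3} (hx : x ∈ U) :
    Function.Periodic (fun θ => jacobian (Φ.act θ) x) (2 * π) := fun θ =>
  jacobian_congr (Filter.eventually_of_mem (hU.mem_nhds hx) fun y hy => Φ.periodic θ y hy)

theorem avgMetric_pullback (hU : IsOpen U) (s : ℝ) {x : V3} (hx : x ∈ U) :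
    (jacobian (Φ.act s) x)ᵀ * avgMetric Φ.act (Φ.act s x) * jacobian (Φ.act s) x =
      avgMetric Φ.act x := by
  set K := jacobian (Φ.act s) x
  set M : ℝ → Matrix (Fin 3) (Fin 3) ℝ := fun θ =>
    (jacobian (Φ.act θ) (Φ.act s x))ᵀ * jacobian (Φ.act θ) (Φ.act s x) with hM
  have hMc : Continuous M := by
    have := Φ.continuous_jacobian hU (Φ.mapsTo s hx)
    exact this.matrix_transpose.matrix_mul this
  have hint : ∀ a b, IntervalIntegrable (fun θ => M θ a b) volume 0 (2 * π) := fun a b =>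
    (hMc.matrix_elem a b).intervalIntegrable _ _
  ext i j
  have hshift : ∫ θ in (0 : ℝ)..(2 * π),
      ((jacobian (Φ.act θ) x)ᵀ * jacobian (Φ.act θ) x) i j =
        ∫ θ in (0 : ℝ)..(2 * π), (Kᵀ * M θ * K) i j := by
    have hper : Function.Periodic
        (fun θ => ((jacobian (Φ.act θ) x)ᵀ * jacobian (Φ.act θ) x) i j) (2 * π) := fun θ => by
      have := Φ.jacobian_act_periodic hU hx θ
      simp only at this
      simp only [this]
    have h := intervalIntegral.integral_comp_add_right (a := 0) (b := 2 * π)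
      (fun θ => ((jacobian (Φ.act θ) x)ᵀ * jacobian (Φ.act θ) x) i j) s
    have h0 := hper.intervalIntegral_add_eq 0 s
    rw [zero_add, add_comm s] at h0
    rw [zero_add] at h
    rw [h0, ← h]
    refine intervalIntegral.integral_congr fun θ _ => ?_
    simp only [Φ.jacobian_act_add hU θ s hx, hM, Matrix.transpose_mul, Matrix.mul_assoc, K]
  have hlin : ∫ θ in (0 : ℝ)..(2 * π), (Kᵀ * M θ * K) i j =
      ∑ b, (∑ a, Kᵀ i a * ∫ θ in (0 : ℝ)..(2 * π), M θ a b) * K b j := by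
    simp only [Matrix.mul_apply (M := Kᵀ * M _), Matrix.mul_apply (M := Kᵀ)]
    rw [intervalIntegral.integral_finsetSum]
    · refine Finset.sum_congr rfl fun b _ => ?_
      rw [intervalIntegral.integral_mul_const, intervalIntegral.integral_finsetSum]
      · simp only [intervalIntegral.integral_const_mul]
      · exact fun a _ => (hint a b).const_mul _
    · refine fun b _ => IntervalIntegrable.mul_const ?_ _
      exact (continuous_finsetSum _ fun a _ =>
        continuous_const.mul (hMc.matrix_elem a b)).intervalIntegrable _ _
  simp only [avgMetric, Matrix.of_apply]
  rw [hshift, hlin]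
  simp only [Matrix.mul_apply (N := K), Matrix.mul_apply (M := Kᵀ), Matrix.of_apply,
    Finset.mul_sum, Finset.sum_mul]
  refine Finset.sum_congr rfl fun b _ => Finset.sum_congr rfl fun a _ => ?_
  simp only [hM]
  ring

theorem preservesFn_det_avgMetric (hU : IsOpen U) (hvol : VolumePreserving U Φ.act) :
    PreservesFn U Φ.act fun y => (avgMetric Φ.act y).det := by
  intro s x hx
  simp only
  rw [← Φ.avgMetric_pullback hU s hx, Matrix.det_mul, Matrix.det_mul, Matrix.det_transpose,
    hvol s x hx, one_mul, mul_one]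

theorem grad_dotProduct_gen_eq_zero (hU : IsOpen U) {f : V3 → ℝ}
    (hf : PreservesFn U Φ.act f) {x : V3} (hx : x ∈ U) :
    grad f x ⬝ᵥ gen Φ.act x = 0 := by
  rw [grad_dotProduct]
  by_cases hd : DifferentiableAt ℝ f x
  · have ho : HasDerivAt (fun θ => Φ.act θ x) (gen Φ.act x) 0 :=
      (Φ.differentiableAt_orbit hU 0 hx).hasDerivAt
    rw [← Φ.act_zero x hx] at hd
    have hc := hd.hasFDerivAt.comp_hasDerivAt 0 ho
    have hconst : (f ∘ fun θ => Φ.act θ x) = fun _ => f x := funext fun θ => hf θ x hx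
    rw [hconst, Φ.act_zero x hx] at hc
    exact hc.unique (hasDerivAt_const _ _)
  · simp [fderiv_zero_of_not_differentiableAt hd]

end SmoothCircleAction

/-- second structure equation, `u ·̄ ∇̄ρ_ḡ = 0`. -/
theorem structure_equation_density
    (U : Set V3) (hU : IsOpen U) (Φ : SmoothCircleAction U)
    (hvol : VolumePreserving U Φ.act)
    (u : V3 → V3) (hu : u = gen Φ.act)
    (g : V3 → Matrix (Fin 3) (Fin 3) ℝ) (hg : g = avgMetric Φ.act) :
    ∀ x ∈ U,
      grad (fun y => (g y).det) x ⬝ᵥ u x = 0 ∧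
      grad (fun y => Real.sqrt (g y).det) x ⬝ᵥ u x = 0 := by
  subst hu hg
  intro x hx
  have h := Φ.preservesFn_det_avgMetric hU hvol
  exact ⟨Φ.grad_dotProduct_gen_eq_zero hU h hx,
    Φ.grad_dotProduct_gen_eq_zero hU (fun θ y hy => congrArg Real.sqrt (h θ y hy)) hx⟩
end
end

section
/- Let Φ be a volume-preserving smooth circle action on an open set U ⊆ ℝ³ with averaged metric ḡ. Let B : U → ℝ³ be C^∞ with J := ∇×B, and assume Φ preserves both B and J (DΦ_θ(x)B(x) = B(Φ(θ,x)) and DΦ_θ(x)J(x) = J(Φ(θ,x)) for all θ, x). Then the curl of the vector field x ↦ ḡ(x)B(x) equals the curl of B: ∇×(ḡB)(x) = (∇×B)(x) for every x ∈ U. -/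
open Matrix MeasureTheory
open scoped Real

noncomputable section

open scoped Topology

theorem pd_congr_of_eventuallyEq {f g : V3 → ℝ} {x : V3} (h : f =ᶠ[𝓝 x] g) (i : Fin 3) :
    pd i f x = pd i g x := by
  simp only [pd, h.fderiv_eq]

theorem curl_congr_of_eventuallyEq {v w : V3 → V3} {x : V3} (h : v =ᶠ[𝓝 x] w) :
    curl v x = curl w x := by
  have hc : ∀ i j, pd j (fun y => v y i) x = pd j (fun y => w y i) x := fun i j =>
    pd_congr_of_eventuallyEq (h.mono fun y hy => congrFun hy i) j
  simp only [curl, hc]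

theorem pd_const_mul (c : ℝ) {f : V3 → ℝ} {x : V3} (hf : DifferentiableAt ℝ f x) (i : Fin 3) :
    pd i (fun y => c * f y) x = c * pd i f x := by
  simp [pd, fderiv_const_mul hf]

/-- Partial derivatives commute. -/
theorem pd_comm {f : V3 → ℝ} {x : V3} (hf : ContDiffAt ℝ 2 f x) (i j : Fin 3) :
    pd i (fun y => pd j f y) x = pd j (fun y => pd i f y) x := by
  have hd : DifferentiableAt ℝ (fderiv ℝ f) x :=
    (hf.fderiv_right (m := 1) (by norm_num)).differentiableAt (by norm_num)
  have hsymm := hf.isSymmSndFDerivAt (by simp)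
  simp only [pd]
  rw [fderiv_clm_apply hd (differentiableAt_const _), fderiv_clm_apply hd (differentiableAt_const _)]
  simpa using hsymm (Pi.single i 1) (Pi.single j 1)

theorem differentiableAt_pd {f : V3 → ℝ} {x : V3} (hf : ContDiffAt ℝ 2 f x) (i : Fin 3) :
    DifferentiableAt ℝ (fun y => pd i f y) x :=
  ((hf.fderiv_right (m := 1) (by norm_num)).differentiableAt (by norm_num)).clm_apply
    (differentiableAt_const _)

/-- The chain rule for partial derivatives. -/
theorem pd_comp {h : V3 → ℝ} {f : V3 → V3} {x : V3} (hh : DifferentiableAt ℝ h (f x))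
    (hf : DifferentiableAt ℝ f x) (i : Fin 3) :
    pd i (fun y => h (f y)) x = ∑ l, pd l h (f x) * pd i (fun y => f y l) x := by
  have hcomp := (hh.hasFDerivAt.comp x hf.hasFDerivAt).fderiv
  have hl : ∀ l, pd i (fun y => f y l) x = fderiv ℝ f x (Pi.single i 1) l := fun l => by
    rw [pd, (hasFDerivAt_pi'.1 hf.hasFDerivAt l).fderiv]
    rfl
  simp only [pd] at hl ⊢
  change fderiv ℝ (h ∘ f) x _ = _
  rw [hcomp, ContinuousLinearMap.comp_apply,
    pi_eq_sum_univ' (fderiv ℝ f x (Pi.single i 1)), map_sum]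
  refine Finset.sum_congr rfl fun l _ => ?_
  rw [hl, map_smul, smul_eq_mul, mul_comm]

/-- The curl of the pullback of a covector field is the cofactor transform of its curl. -/
theorem curl_pullback {f B : V3 → V3} {x : V3} (hf : ContDiffAt ℝ 2 f x)
    (hB : DifferentiableAt ℝ B (f x)) :
    curl (fun y => (jacobian f y)ᵀ.mulVec (B (f y))) x =
      (jacobian f x).adjugate.mulVec (curl B (f x)) := by
  have hfk : ∀ k, ContDiffAt ℝ 2 (fun y => f y k) x := contDiffAt_pi.1 hf
  have hfd : DifferentiableAt ℝ f x := hf.differentiableAt (by norm_num)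
  have hBk : ∀ k, DifferentiableAt ℝ (fun y => B y k) (f x) := differentiableAt_pi.1 hB
  have key : ∀ i j, pd j (fun y => (jacobian f y)ᵀ.mulVec (B (f y)) i) x =
      ∑ k, (pd i (fun y => f y k) x *
          (∑ l, pd l (fun y => B y k) (f x) * pd j (fun y => f y l) x) +
        B (f x) k * pd j (fun y => pd i (fun y => f y k) y) x) := by
    intro i j
    have hterm : ∀ k, HasFDerivAt (fun y => pd i (fun y => f y k) y * B (f y) k) _ x := fun k =>
      (differentiableAt_pd (hfk k) i).hasFDerivAt.mul
        (DifferentiableAt.comp x (hBk k) hfd).hasFDerivAt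
    have hsum := (HasFDerivAt.fun_sum (u := Finset.univ) fun k _ => hterm k).fderiv
    change fderiv ℝ (fun y => ∑ k, pd i (fun y => f y k) y * B (f y) k) x _ = _
    rw [hsum]
    simp only [← pd_comp (hBk _) hfd]
    simp [pd, Function.comp_def]
  simp only [curl, key, pd_comm (hfk _) 1 0, pd_comm (hfk _) 2 0, pd_comm (hfk _) 2 1,
    adjugate_fin_three]
  ext i
  fin_cases i <;> simp [jacobian, Fin.sum_univ_three, Matrix.mulVec, dotProduct] <;> ring

section Parametric

variable {U : Set V3} {F : ℝ × V3 → ℝ}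

theorem hasFDerivAt_slice (hU : IsOpen U) (hF : ContDiffOn ℝ 1 F (Set.univ ×ˢ U))
    (θ : ℝ) {x : V3} (hx : x ∈ U) :
    HasFDerivAt (fun y => F (θ, y))
      ((fderiv ℝ F (θ, x)).comp (ContinuousLinearMap.inr ℝ ℝ V3)) x := by
  have hd : DifferentiableAt ℝ F (θ, x) :=
    (hF.contDiffAt ((isOpen_univ.prod hU).mem_nhds ⟨trivial, hx⟩)).differentiableAt (by norm_num)
  exact hd.hasFDerivAt.comp x (hasFDerivAt_prodMk_right θ x)

theorem contDiffOn_pd_slice (hU : IsOpen U) (hF : ContDiffOn ℝ (⊤ : ℕ∞) F (Set.univ ×ˢ U))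
    (i : Fin 3) :
    ContDiffOn ℝ (⊤ : ℕ∞) (fun p : ℝ × V3 => pd i (fun y => F (p.1, y)) p.2)
      (Set.univ ×ˢ U) := by
  have hF1 : ContDiffOn ℝ 1 F (Set.univ ×ˢ U) := hF.of_le (by exact_mod_cast le_top)
  have hd : ContDiffOn ℝ (⊤ : ℕ∞) (fun p => fderiv ℝ F p (0, Pi.single i 1)) (Set.univ ×ˢ U) :=
    (hF.fderiv_of_isOpen (isOpen_univ.prod hU) (by exact_mod_cast le_top)).clm_apply
      contDiffOn_const
  refine hd.congr fun p hp => ?_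
  rw [pd, (hasFDerivAt_slice hU hF1 p.1 hp.2).fderiv]
  simp

theorem continuous_slice (hF : ContinuousOn F (Set.univ ×ˢ U)) {x : V3} (hx : x ∈ U) :
    Continuous fun θ => F (θ, x) :=
  hF.comp_continuous (by fun_prop) fun _ => ⟨trivial, hx⟩

/-- Differentiation under the integral sign over a compact interval. -/
theorem hasFDerivAt_integral_slice (hU : IsOpen U) (hF : ContDiffOn ℝ 1 F (Set.univ ×ˢ U))
    (a b : ℝ) {x : V3} (hx : x ∈ U) :
    HasFDerivAt (fun y => ∫ θ in a..b, F (θ, y))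
      (∫ θ in a..b, (fderiv ℝ F (θ, x)).comp (ContinuousLinearMap.inr ℝ ℝ V3)) x := by
  obtain ⟨r, hr, hrU⟩ := Metric.nhds_basis_closedBall.mem_iff.1 (hU.mem_nhds hx)
  have hF' : ContinuousOn (fun p => (fderiv ℝ F p).comp (ContinuousLinearMap.inr ℝ ℝ V3))
      (Set.univ ×ˢ U) :=
    (hF.continuousOn_fderiv_of_isOpen (isOpen_univ.prod hU) le_rfl).clm_comp continuousOn_const
  obtain ⟨C, hC⟩ := (isCompact_uIcc.prod (isCompact_closedBall x r)).exists_bound_of_continuousOn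
    (hF'.mono (Set.prod_mono (Set.subset_univ (Set.uIcc a b)) hrU))
  refine intervalIntegral.hasFDerivAt_integral_of_dominated_of_fderiv_le
    (F := fun y θ => F (θ, y))
    (F' := fun y θ => (fderiv ℝ F (θ, y)).comp (ContinuousLinearMap.inr ℝ ℝ V3))
    (bound := fun _ => C) (Metric.closedBall_mem_nhds x hr) ?_ ?_ ?_ ?_ ?_ ?_
  · filter_upwards [hU.mem_nhds hx] with y hy
    exact (continuous_slice hF.continuousOn hy).aestronglyMeasurable
  · exact (continuous_slice hF.continuousOn hx).intervalIntegrable _ _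
  · exact (hF'.comp_continuous (by fun_prop) fun _ => ⟨trivial, hx⟩).aestronglyMeasurable
  · exact .of_forall fun θ hθ y hy => hC (θ, y) ⟨Set.uIoc_subset_uIcc hθ, hy⟩
  · exact intervalIntegrable_const
  · exact .of_forall fun θ _ y hy => hasFDerivAt_slice hU hF θ (hrU hy)

theorem pd_integral_slice (hU : IsOpen U) (hF : ContDiffOn ℝ 1 F (Set.univ ×ˢ U))
    (a b : ℝ) {x : V3} (hx : x ∈ U) (i : Fin 3) :
    pd i (fun y => ∫ θ in a..b, F (θ, y)) x = ∫ θ in a..b, pd i (fun y => F (θ, y)) x := by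
  have hF' : ContinuousOn (fun p => (fderiv ℝ F p).comp (ContinuousLinearMap.inr ℝ ℝ V3))
      (Set.univ ×ˢ U) :=
    (hF.continuousOn_fderiv_of_isOpen (isOpen_univ.prod hU) le_rfl).clm_comp continuousOn_const
  have hint : IntervalIntegrable
      (fun θ => (fderiv ℝ F (θ, x)).comp (ContinuousLinearMap.inr ℝ ℝ V3)) volume a b :=
    (hF'.comp_continuous (by fun_prop) fun _ => ⟨trivial, hx⟩).intervalIntegrable _ _
  rw [pd, (hasFDerivAt_integral_slice hU hF a b hx).fderiv,
    ContinuousLinearMap.intervalIntegral_apply hint]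
  simp only [pd, (hasFDerivAt_slice hU hF _ hx).fderiv]

/-- The curl of an average of vector fields is the average of their curls. -/
theorem curl_integral {W : ℝ → V3 → V3} (hU : IsOpen U)
    (hW : ∀ i, ContDiffOn ℝ (⊤ : ℕ∞) (fun p : ℝ × V3 => W p.1 p.2 i) (Set.univ ×ˢ U))
    (c a b : ℝ) {x : V3} (hx : x ∈ U) (k : Fin 3) :
    curl (fun y i => c * ∫ θ in a..b, W θ y i) x k = c * ∫ θ in a..b, curl (W θ) x k := by
  have hW1 : ∀ i, ContDiffOn ℝ 1 (fun p : ℝ × V3 => W p.1 p.2 i) (Set.univ ×ˢ U) :=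
    fun i => (hW i).of_le (by exact_mod_cast le_top)
  have hpd : ∀ i j, pd j (fun y => c * ∫ θ in a..b, W θ y i) x =
      c * ∫ θ in a..b, pd j (fun y => W θ y i) x := fun i j => by
    rw [pd_const_mul c (hasFDerivAt_integral_slice hU (hW1 i) a b hx).differentiableAt,
      pd_integral_slice hU (hW1 i) a b hx]
  have hint : ∀ i j, IntervalIntegrable (fun θ => pd j (fun y => W θ y i) x) volume a b :=
    fun i j => (continuous_slice (contDiffOn_pd_slice hU (hW i) j).continuousOn
      hx).intervalIntegrable _ _
  fin_cases k <;>
    simp [curl, hpd, intervalIntegral.integral_sub (hint _ _) (hint _ _), mul_sub]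

end Parametric

namespace SmoothCircleAction

variable {U : Set V3} (Φ : SmoothCircleAction U)

theorem contDiffOn_act (θ : ℝ) : ContDiffOn ℝ (⊤ : ℕ∞) (Φ.act θ) U :=
  Φ.smooth.comp (f := fun y => (θ, y)) (by fun_prop) fun _ hy => ⟨trivial, hy⟩

theorem contDiffOn_jacobian (hU : IsOpen U) (i j : Fin 3) :
    ContDiffOn ℝ (⊤ : ℕ∞) (fun p : ℝ × V3 => jacobian (Φ.act p.1) p.2 i j) (Set.univ ×ˢ U) :=
  contDiffOn_pd_slice hU (contDiffOn_pi.1 Φ.smooth i) j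

theorem contDiffOn_pullback (hU : IsOpen U) {B : V3 → V3} (hB : ContDiffOn ℝ (⊤ : ℕ∞) B U)
    (i : Fin 3) :
    ContDiffOn ℝ (⊤ : ℕ∞)
      (fun p : ℝ × V3 => (jacobian (Φ.act p.1) p.2)ᵀ.mulVec (B (Φ.act p.1 p.2)) i)
      (Set.univ ×ˢ U) := by
  simp only [Matrix.mulVec, dotProduct, Matrix.transpose_apply]
  exact ContDiffOn.sum fun k _ => (Φ.contDiffOn_jacobian hU k i).mul
    (contDiffOn_pi.1 (hB.comp Φ.smooth fun p hp => Φ.mapsTo p.1 hp.2) k)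

/-- For a preserved field, lowering an index with the averaged metric is averaging the
covector field. -/
theorem avgMetric_mulVec (hU : IsOpen U) {B : V3 → V3} (hPB : PreservesVec U Φ.act B)
    {y : V3} (hy : y ∈ U) : (avgMetric Φ.act y).mulVec (B y) = avgCov Φ.act B y := by
  have hjac : ∀ i j, Continuous fun θ => jacobian (Φ.act θ) y i j := fun i j =>
    continuous_slice (Φ.contDiffOn_jacobian hU i j).continuousOn hy
  ext i
  have hpt : ∀ θ, (jacobian (Φ.act θ) y)ᵀ.mulVec (B (Φ.act θ y)) i =
      ∑ j, ((jacobian (Φ.act θ) y)ᵀ * jacobian (Φ.act θ) y) i j * B y j := fun θ => by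
    rw [← hPB θ y hy, Matrix.mulVec_mulVec]
    rfl
  have hcont : ∀ j, Continuous fun θ =>
      ((jacobian (Φ.act θ) y)ᵀ * jacobian (Φ.act θ) y) i j * B y j := fun j => by
    simp only [Matrix.mul_apply, Matrix.transpose_apply]
    exact (continuous_finsetSum _ fun k _ => (hjac k i).mul (hjac k j)).mul continuous_const
  simp only [avgCov, hpt]
  rw [intervalIntegral.integral_finsetSum fun j _ => (hcont j).intervalIntegrable _ _,
    Finset.mul_sum]
  simp only [intervalIntegral.integral_mul_const, ← mul_assoc]
  rfl

/-- If a volume-preserving action preserves `curl B`, it preserves it as a two-form. -/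
theorem curl_pullback_eq (hU : IsOpen U) (hvol : VolumePreserving U Φ.act) {B : V3 → V3}
    (hB : ContDiffOn ℝ (⊤ : ℕ∞) B U) (hPJ : PreservesVec U Φ.act (curl B)) (θ : ℝ)
    {x : V3} (hx : x ∈ U) :
    curl (fun y => (jacobian (Φ.act θ) y)ᵀ.mulVec (B (Φ.act θ y))) x = curl B x := by
  rw [curl_pullback
      (((Φ.contDiffOn_act θ).contDiffAt (hU.mem_nhds hx)).of_le
        (WithTop.coe_le_coe.2 (le_top : (2 : ℕ∞) ≤ ⊤)))
      ((hB.contDiffAt (hU.mem_nhds (Φ.mapsTo θ hx))).differentiableAt (by simp)),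
    ← hPJ θ x hx, Matrix.mulVec_mulVec, Matrix.adjugate_mul, hvol θ x hx, one_smul,
    Matrix.one_mulVec]

end SmoothCircleAction

/-- for a symmetric field, the curl of `ḡB` equals the curl of `B`. -/
theorem curl_avg_metric_B
    (U : Set V3) (hU : IsOpen U) (Φ : SmoothCircleAction U)
    (hvol : VolumePreserving U Φ.act)
    (g : V3 → Matrix (Fin 3) (Fin 3) ℝ) (hg : g = avgMetric Φ.act)
    (B : V3 → V3) (hB : ContDiffOn ℝ (⊤ : ℕ∞) B U)
    (J : V3 → V3) (hJ : J = fun x => curl B x)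
    (hPB : PreservesVec U Φ.act B) (hPJ : PreservesVec U Φ.act J) :
    ∀ x ∈ U, curl (fun y => (g y).mulVec (B y)) x = curl B x := by
  subst hg hJ
  intro x hx
  have hev : (fun y => (avgMetric Φ.act y).mulVec (B y)) =ᶠ[𝓝 x] avgCov Φ.act B := by
    filter_upwards [hU.mem_nhds hx] with y hy using Φ.avgMetric_mulVec hU hPB hy
  rw [curl_congr_of_eventuallyEq hev]
  ext k
  refine (curl_integral hU (Φ.contDiffOn_pullback hU hB) _ _ _ hx k).trans ?_
  simp only [Φ.curl_pullback_eq hU hvol hB hPJ _ hx, intervalIntegral.integral_const, smul_eq_mul]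
  field_simp
  ring
end
end
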